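/- arXiv:math/0406120 — 2 statements merged into one kernel-verified Lean document; each statement's English description precedes it below -/
import Mathlib

section
/- The function t ↦ ξ'(t)/t is strictly increasing on (0, π/2), where ξ(t) = (cos²t + 2t·sin t·cos t + t² − π²/4)/cos²t. -/
open Real Set

noncomputable def xi (t : ℝ) : ℝ :=
  (Real.cos t ^ 2 + 2 * t * Real.sin t * Real.cos t + t ^ 2 - Real.pi ^ 2 / 4) / Real.cos t ^ 2

open Filter Topology

/-- The Mittag-Leffler expansion of the tangent, in terms of partial sums. -/
theorem tendsto_sum_tan_partial_fractions {v : ℝ} (hv : v ∈ Ioo (-(1 / 2) : ℝ) (1 / 2)) :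
    Tendsto (fun N : ℕ => ∑ k ∈ Finset.range N, 2 * v / (((k : ℝ) + 1 / 2) ^ 2 - v ^ 2)) atTop
      (𝓝 (π * tan (π * v))) := by
  obtain ⟨hv1, hv2⟩ := hv
  obtain ⟨s, rfl⟩ : ∃ s : ℝ, v = 1 / 2 - s := ⟨1 / 2 - v, by ring⟩
  have hs0 : 0 < s := by linarith
  have hs1 : s < 1 := by linarith
  have hs : (s : ℂ) ∈ Complex.integerComplement := by
    rintro ⟨n, hn⟩
    have hn' : (n : ℝ) = s := by exact_mod_cast hn
    have h0 : (0 : ℝ) < n := hn' ▸ hs0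
    have h1 : (n : ℝ) < 1 := hn' ▸ hs1
    norm_cast at h0 h1
    omega
  have hcot : Tendsto (fun N : ℕ => ∑ j ∈ Finset.range N,
      (1 / (s - (j + 1)) + 1 / (s + (j + 1)))) atTop (𝓝 (π * cot (π * s) - 1 / s)) := by
    have h := (Complex.continuous_re.tendsto _).comp (tendsto_logDeriv_euler_cot_sub hs)
    have hlim : ((π : ℂ) * Complex.cot (π * s) - 1 / s).re = π * cot (π * s) - 1 / s := by
      rw [← Complex.ofReal_re (π * cot (π * s) - 1 / s)]
      push_cast
      rfl
    rw [hlim] at h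
    refine h.congr fun N => ?_
    rw [← Complex.ofReal_re (∑ j ∈ Finset.range N, _)]
    push_cast
    rfl
  have hvanish : Tendsto (fun N : ℕ => 1 / (s + N)) atTop (𝓝 0) := by
    simp only [one_div]
    exact (tendsto_atTop_add_const_left _ _ tendsto_natCast_atTop_atTop).inv_tendsto_atTop
  have hpartial (N : ℕ) : ∑ k ∈ Finset.range N,
      2 * (1 / 2 - s) / (((k : ℝ) + 1 / 2) ^ 2 - (1 / 2 - s) ^ 2) =
      1 / s + ∑ j ∈ Finset.range N, (1 / (s - (j + 1)) + 1 / (s + (j + 1))) - 1 / (s + N) := by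
    induction N with
    | zero => simp
    | succ n ih =>
      rw [Finset.sum_range_succ, Finset.sum_range_succ, ih]
      have hn : (0 : ℝ) ≤ n := n.cast_nonneg
      have h1 : s + n ≠ 0 := by positivity
      have h2 : s - (n + 1) ≠ 0 := by linarith
      have h3 : ((n : ℝ) + 1 / 2) ^ 2 - (1 / 2 - s) ^ 2 = -((s + n) * (s - (n + 1))) := by ring
      have h4 : 2 * (1 / 2 - s) / (((n : ℝ) + 1 / 2) ^ 2 - (1 / 2 - s) ^ 2) =
          1 / (s + n) + 1 / (s - (n + 1)) := by
        rw [h3]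
        field_simp
        ring
      rw [h4]
      push_cast
      ring
  simp only [hpartial]
  have htan : tan (π * (1 / 2 - s)) = cot (π * s) := by
    rw [show π * (1 / 2 - s) = π / 2 - π * s by ring, tan_pi_div_two_sub, tan_eq_sin_div_cos,
      inv_div, cot_eq_cos_div_sin]
  rw [htan]
  convert (hcot.const_add (1 / s)).sub hvanish using 2
  ring

theorem hasDerivAt_tan_partial_fraction {c v : ℝ} (h : c ^ 2 - v ^ 2 ≠ 0) :
    HasDerivAt (fun v => 2 * v / (c ^ 2 - v ^ 2))
      (2 * (c ^ 2 + v ^ 2) / (c ^ 2 - v ^ 2) ^ 2) v := by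
  have h1 : HasDerivAt (fun v : ℝ => 2 * v) (2 * 1) v := (hasDerivAt_id v).const_mul 2
  have h2 : HasDerivAt (fun v : ℝ => c ^ 2 - v ^ 2) (-(2 * v)) v := by
    simpa using (hasDerivAt_pow 2 v).const_sub (c ^ 2)
  convert! h1.div h2 h using 1
  ring

theorem sq_sub_sq_bound {v : ℝ} (hv : v ∈ Ioo (-(1 / 2) : ℝ) (1 / 2)) (k : ℕ) :
    ((k : ℝ) + 1) * (k + 2) ≤ ((k : ℝ) + 3 / 2) ^ 2 - v ^ 2 := by
  nlinarith [mul_pos (sub_pos.2 hv.1) (sub_pos.2 hv.2)]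

theorem norm_tan_partial_fraction_deriv_le {v : ℝ} (hv : v ∈ Ioo (-(1 / 2) : ℝ) (1 / 2)) (k : ℕ) :
    ‖2 * (((k : ℝ) + 3 / 2) ^ 2 + v ^ 2) / (((k : ℝ) + 3 / 2) ^ 2 - v ^ 2) ^ 2‖ ≤
      4 * (1 / ((k : ℝ) + 1) ^ 2) := by
  have h := sq_sub_sq_bound hv k
  have hk : (0 : ℝ) ≤ k := k.cast_nonneg
  have hv2 : v ^ 2 ≤ 1 / 4 := by nlinarith [mul_pos (sub_pos.2 hv.1) (sub_pos.2 hv.2)]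
  rw [Real.norm_of_nonneg (by positivity)]
  calc _ ≤ 2 * (2 * (((k : ℝ) + 1) * (k + 2))) / (((k : ℝ) + 1) * (k + 2)) ^ 2 := by
        gcongr
        nlinarith
    _ = 4 * (1 / (((k : ℝ) + 1) * (k + 2))) := by
        field_simp
        norm_num
    _ ≤ 4 * (1 / ((k : ℝ) + 1) ^ 2) := by
        gcongr
        nlinarith

theorem summable_four_mul_one_div_succ_sq :
    Summable fun k : ℕ => 4 * (1 / ((k : ℝ) + 1) ^ 2) := by
  have h := (summable_nat_add_iff 1).2 (Real.summable_one_div_nat_pow.2 one_lt_two)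
  simpa using h.mul_left 4

theorem hasSum_tan {v : ℝ} (hv : v ∈ Ioo (-(1 / 2) : ℝ) (1 / 2)) :
    HasSum (fun k : ℕ => 2 * v / (((k : ℝ) + 3 / 2) ^ 2 - v ^ 2))
      (π * tan (π * v) - 2 * v / ((1 / 2) ^ 2 - v ^ 2)) := by
  have hsum : Summable fun k : ℕ => 2 * v / (((k : ℝ) + 3 / 2) ^ 2 - v ^ 2) := by
    refine summable_four_mul_one_div_succ_sq.of_norm_bounded fun k => ?_
    have h := sq_sub_sq_bound hv k
    have hk : (0 : ℝ) ≤ k := k.cast_nonneg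
    have hle : ((k : ℝ) + 1) ^ 2 ≤ ((k : ℝ) + 3 / 2) ^ 2 - v ^ 2 := by nlinarith
    have hpos : 0 < ((k : ℝ) + 3 / 2) ^ 2 - v ^ 2 := lt_of_lt_of_le (by positivity) hle
    have hnum : |2 * v| ≤ 4 := abs_le.2 ⟨by linarith [hv.1], by linarith [hv.2]⟩
    rw [norm_div, Real.norm_eq_abs, Real.norm_of_nonneg hpos.le, mul_one_div]
    gcongr
  rw [hsum.hasSum_iff_tendsto_nat]
  have h := (tendsto_add_atTop_iff_nat 1).2 (tendsto_sum_tan_partial_fractions hv)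
  refine (h.sub_const (2 * v / ((1 / 2) ^ 2 - v ^ 2))).congr fun N => ?_
  rw [Finset.sum_range_succ']
  push_cast
  simp only [zero_add, add_sub_cancel_right]
  refine Finset.sum_congr rfl fun k _ => ?_
  ring_nf

theorem half_sq_sub_sq_pos {v : ℝ} (hv : v ∈ Ioo (-(1 / 2) : ℝ) (1 / 2)) :
    0 < (1 / 2 : ℝ) ^ 2 - v ^ 2 := by
  nlinarith [mul_pos (sub_pos.2 hv.1) (sub_pos.2 hv.2)]

theorem cos_pi_mul_pos {v : ℝ} (hv : v ∈ Ioo (-(1 / 2) : ℝ) (1 / 2)) : 0 < cos (π * v) :=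
  cos_pos_of_mem_Ioo ⟨by nlinarith [hv.1, pi_pos], by nlinarith [hv.2, pi_pos]⟩

theorem hasSum_sec_sq {v : ℝ} (hv : v ∈ Ioo (-(1 / 2) : ℝ) (1 / 2)) :
    HasSum (fun k : ℕ =>
        2 * (((k : ℝ) + 3 / 2) ^ 2 + v ^ 2) / (((k : ℝ) + 3 / 2) ^ 2 - v ^ 2) ^ 2)
      (π ^ 2 / cos (π * v) ^ 2 - 2 * ((1 / 2) ^ 2 + v ^ 2) / ((1 / 2) ^ 2 - v ^ 2) ^ 2) := by
  have hne {w : ℝ} (hw : w ∈ Ioo (-(1 / 2) : ℝ) (1 / 2)) (k : ℕ) :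
      ((k : ℝ) + 3 / 2) ^ 2 - w ^ 2 ≠ 0 :=
    (lt_of_lt_of_le (by positivity) (sq_sub_sq_bound hw k)).ne'
  have h1 := hasDerivAt_tsum_of_isPreconnected summable_four_mul_one_div_succ_sq isOpen_Ioo
    isPreconnected_Ioo (fun k w hw => hasDerivAt_tan_partial_fraction (hne hw k))
    (fun k w hw => norm_tan_partial_fraction_deriv_le hw k) hv (hasSum_tan hv).summable hv
  have h2 : HasDerivAt (fun w => π * tan (π * w)) (π ^ 2 / cos (π * v) ^ 2) v := by
    have hlin : HasDerivAt (fun w => π * w) π v := by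
      simpa using (hasDerivAt_id v).const_mul π
    convert! ((hasDerivAt_tan (cos_pi_mul_pos hv).ne').comp v hlin).const_mul π using 1
    ring
  have h3 := h2.sub (hasDerivAt_tan_partial_fraction (half_sq_sub_sq_pos hv).ne')
  have heq : (fun w : ℝ => ∑' k : ℕ, 2 * w / (((k : ℝ) + 3 / 2) ^ 2 - w ^ 2)) =ᶠ[𝓝 v]
      fun w => π * tan (π * w) - 2 * w / ((1 / 2) ^ 2 - w ^ 2) := by
    filter_upwards [isOpen_Ioo.mem_nhds hv] with w hw using (hasSum_tan hw).tsum_eq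
  rw [(h3.congr_of_eventuallyEq heq).unique h1]
  exact (summable_four_mul_one_div_succ_sq.of_norm_bounded
    fun k => norm_tan_partial_fraction_deriv_le hv k).hasSum

/-- The terms of the partial fraction expansion of `xi (π * √x)`. -/
noncomputable def xiTerm (b x : ℝ) : ℝ :=
  -2 - 2 * (b - 1 / 4) / (b - x) + 4 * b * (b - 1 / 4) / (b - x) ^ 2

noncomputable def xiTermDeriv (b x : ℝ) : ℝ :=
  2 * (b - 1 / 4) * (3 * b + x) / (b - x) ^ 3

theorem hasDerivAt_xiTerm {b x : ℝ} (h : b - x ≠ 0) :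
    HasDerivAt (xiTerm b) (xiTermDeriv b x) x := by
  have h0 : HasDerivAt (fun x => b - x) (-1) x := by
    simpa using (hasDerivAt_id x).const_sub b
  have h1 := (hasDerivAt_const x (2 * (b - 1 / 4))).div h0 h
  have h2 := (hasDerivAt_const x (4 * b * (b - 1 / 4))).div (h0.pow 2) (pow_ne_zero 2 h)
  convert! (h1.const_sub (-2)).add h2 using 1
  unfold xiTermDeriv
  simp only [Pi.pow_apply]
  field_simp
  ring

theorem strictMonoOn_xiTermDeriv {b : ℝ} (hb : 1 / 4 < b) :
    StrictMonoOn (xiTermDeriv b) (Ioo 0 (1 / 4)) := by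
  intro x hx y hy hxy
  have hy' : 0 < b - y := by linarith [hy.2]
  have hb' : 0 < b - 1 / 4 := by linarith
  have hx0 := hx.1
  have hb0 : 0 < 3 * b + y := by linarith [hy.1]
  unfold xiTermDeriv
  gcongr

theorem convexOn_xiTerm {b : ℝ} (hb : 1 / 4 < b) : ConvexOn ℝ (Ioo 0 (1 / 4)) (xiTerm b) := by
  have hd : ∀ x ∈ Ioo (0 : ℝ) (1 / 4), HasDerivAt (xiTerm b) (xiTermDeriv b x) x :=
    fun x hx => hasDerivAt_xiTerm (by linarith [hx.2])
  apply MonotoneOn.convexOn_of_deriv (convex_Ioo _ _)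
  · exact fun x hx => (hd x hx).continuousAt.continuousWithinAt
  · rw [interior_Ioo]
    exact fun x hx => (hd x hx).differentiableAt.differentiableWithinAt
  · rw [interior_Ioo]
    exact (strictMonoOn_xiTermDeriv hb).monotoneOn.congr fun x hx => (hd x hx).deriv.symm

theorem ConvexOn.hasSum {ι : Type*} {s : Set ℝ} {f : ι → ℝ → ℝ} {g : ℝ → ℝ} (hs : Convex ℝ s)
    (hf : ∀ i, ConvexOn ℝ s (f i)) (hg : ∀ x ∈ s, HasSum (fun i => f i x) (g x)) :
    ConvexOn ℝ s g := by
  refine ⟨hs, fun x hx y hy a b ha hb hab => ?_⟩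
  exact hasSum_le (fun i => (hf i).2 hx hy ha hb hab) (hg _ (hs hx hy ha hb hab))
    (((hg x hx).const_smul a).add ((hg y hy).const_smul b))

theorem hasSum_xi {v : ℝ} (hv : v ∈ Ioo (-(1 / 2) : ℝ) (1 / 2)) :
    HasSum (fun k : ℕ => xiTerm (((k : ℝ) + 3 / 2) ^ 2) (v ^ 2)) (xi (π * v) + 1) := by
  have h := ((hasSum_tan hv).mul_left (2 * v)).add
    ((hasSum_sec_sq hv).mul_left (v ^ 2 - 1 / 4))
  convert! h using 1
  · ext k
    have hpos : 0 < ((k : ℝ) + 3 / 2) ^ 2 - v ^ 2 :=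
      lt_of_lt_of_le (by positivity) (sq_sub_sq_bound hv k)
    generalize ((k : ℝ) + 3 / 2) ^ 2 = b at hpos ⊢
    unfold xiTerm
    field_simp
    ring
  · have hc := (cos_pi_mul_pos hv).ne'
    have hpos := half_sq_sub_sq_pos hv
    have hfirst : 2 * v * (2 * v / ((1 / 2) ^ 2 - v ^ 2)) + (v ^ 2 - 1 / 4) *
        (2 * ((1 / 2) ^ 2 + v ^ 2) / ((1 / 2) ^ 2 - v ^ 2) ^ 2) = -2 := by
      have hq : v ^ 2 - 1 / 4 = -((1 / 2) ^ 2 - v ^ 2) := by ring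
      rw [hq]
      generalize hD : (1 / 2 : ℝ) ^ 2 - v ^ 2 = D at hpos ⊢
      field_simp
      linear_combination (-4) * hD
    have hxi : xi (π * v) = 1 + 2 * v * (π * tan (π * v)) +
        (v ^ 2 - 1 / 4) * (π ^ 2 / cos (π * v) ^ 2) := by
      rw [xi, tan_eq_sin_div_cos]
      field_simp
      ring
    linear_combination hxi + hfirst

theorem differentiableAt_xi {t : ℝ} (ht : cos t ≠ 0) : DifferentiableAt ℝ xi t := by
  unfold xi
  fun_prop (disch := simpa using ht)

theorem hasDerivAt_xi_pi_mul_sqrt {x : ℝ} (hx : x ∈ Ioo (0 : ℝ) (1 / 4)) :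
    HasDerivAt (fun x => xi (π * √x)) (deriv xi (π * √x) / (π * √x) * (π ^ 2 / 2)) x := by
  have hpos : 0 < √x := sqrt_pos.2 hx.1
  have hlt : √x < 1 / 2 := (sqrt_lt' (by norm_num)).2 (by linarith [hx.2])
  have hcos := (cos_pi_mul_pos ⟨by linarith, hlt⟩).ne'
  have h := (differentiableAt_xi hcos).hasDerivAt.comp x
    ((hasDerivAt_sqrt hx.1.ne').const_mul π)
  convert! h using 1
  field_simp

theorem strictMonoOn_deriv_xi_sqrt :
    StrictMonoOn (fun x => deriv xi (π * √x) / (π * √x)) (Ioo 0 (1 / 4)) := by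
  set h : ℝ → ℝ := fun x => xi (π * √x) + 1 - xiTerm (9 / 4) x with h_def
  have hconv : ConvexOn ℝ (Ioo 0 (1 / 4)) h := by
    refine ConvexOn.hasSum (f := fun k : ℕ => xiTerm (((k : ℝ) + 1 + 3 / 2) ^ 2)) (convex_Ioo _ _)
      (fun k => convexOn_xiTerm (by nlinarith [(k.cast_nonneg : (0 : ℝ) ≤ k)])) fun x hx => ?_
    have hpos : 0 < √x := sqrt_pos.2 hx.1
    have hlt : √x < 1 / 2 := (sqrt_lt' (by norm_num)).2 (by linarith [hx.2])
    have hs := (hasSum_nat_add_iff' 1).2 (hasSum_xi (v := √x) ⟨by linarith, hlt⟩)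
    simp only [sq_sqrt hx.1.le, Finset.sum_range_one] at hs
    convert! hs using 1
    · push_cast
      rfl
    · norm_num [h_def]
  have hd : ∀ x ∈ Ioo (0 : ℝ) (1 / 4), HasDerivAt h
      (deriv xi (π * √x) / (π * √x) * (π ^ 2 / 2) - xiTermDeriv (9 / 4) x) x := fun x hx =>
    ((hasDerivAt_xi_pi_mul_sqrt hx).add_const 1).sub (hasDerivAt_xiTerm (by linarith [hx.2]))
  have hmono := hconv.monotoneOn_deriv fun x hx => (hd x hx).differentiableAt
  intro x hx y hy hxy
  have h1 := hmono hx hy hxy.le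
  rw [(hd x hx).deriv, (hd y hy).deriv] at h1
  have h2 := strictMonoOn_xiTermDeriv (b := 9 / 4) (by norm_num) hx hy hxy
  exact lt_of_mul_lt_mul_right (by linarith) (by positivity : 0 ≤ π ^ 2 / 2)

theorem stmt_12 : StrictMonoOn (fun t => deriv xi t / t) (Ioo 0 (π / 2)) := by
  have hsqrt {t : ℝ} (ht : t ∈ Ioo 0 (π / 2)) : π * √((t / π) ^ 2) = t := by
    rw [sqrt_sq (div_pos ht.1 pi_pos).le, mul_div_cancel₀ _ pi_ne_zero]
  have hmem {t : ℝ} (ht : t ∈ Ioo 0 (π / 2)) : (t / π) ^ 2 ∈ Ioo (0 : ℝ) (1 / 4) := by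
    have hpos := div_pos ht.1 pi_pos
    have hlt : t / π < 1 / 2 := by
      rw [div_lt_iff₀ pi_pos]
      linarith [ht.2]
    exact ⟨by positivity, by nlinarith⟩
  intro s hs t ht hst
  have hpos := div_pos hs.1 pi_pos
  have h := strictMonoOn_deriv_xi_sqrt (hmem hs) (hmem ht) (by gcongr)
  simpa only [hsqrt hs, hsqrt ht] using h
end

section
/- For t ∈ (0, π/2): 2(3 − π²/4) ≤ ξ'(t)/t ≤ 4/3, where ξ(t) = (cos²t + 2t·sin t·cos t + t² − π²/4)/cos²t, and the limit of ξ'(t)/t as t → 0 is ξ''(0) = 2(3 − π²/4) while the limit as t → π/2⁻ is 4/3. -/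
open Real Set

open Filter Topology

/-- The numerator of `ξ'`: one has `ξ' = 2 * xiNum / cos ^ 3`. -/
noncomputable def xiNum (t : ℝ) : ℝ :=
  sin t * cos t ^ 2 + 2 * t * cos t + (t ^ 2 - π ^ 2 / 4) * sin t

theorem hasDerivAt_xi {t : ℝ} (hc : cos t ≠ 0) :
    HasDerivAt xi (2 * xiNum t / cos t ^ 3) t := by
  have hs := hasDerivAt_sin t
  have hcos := hasDerivAt_cos t
  have hid := hasDerivAt_id' t
  have h := ((((hcos.pow 2).add (((hid.const_mul 2).mul hs).mul hcos)).add
    (hid.pow 2)).sub_const (π ^ 2 / 4)).div (hcos.pow 2) (pow_ne_zero 2 hc)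
  refine h.congr_deriv ?_
  simp only [xiNum, Pi.add_apply, Pi.mul_apply, Pi.pow_apply]
  have e := sin_sq_add_cos_sq t
  field_simp
  push_cast
  simp only [pow_one]
  linear_combination (8 * t * cos t ^ 2) * e

theorem deriv_xi {t : ℝ} (hc : cos t ≠ 0) : deriv xi t = 2 * xiNum t / cos t ^ 3 :=
  (hasDerivAt_xi hc).deriv

theorem hasDerivAt_xiNum_zero : HasDerivAt xiNum (3 - π ^ 2 / 4) 0 := by
  have hs := hasDerivAt_sin 0
  have hcos := hasDerivAt_cos 0
  have hid := hasDerivAt_id' (0 : ℝ)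
  have h := ((hs.mul (hcos.pow 2)).add ((hid.const_mul 2).mul hcos)).add
    (((hid.pow 2).sub_const (π ^ 2 / 4)).mul hs)
  refine h.congr_deriv ?_
  simp
  ring

theorem hasDerivAt_deriv_xi_zero : HasDerivAt (deriv xi) (2 * (3 - π ^ 2 / 4)) 0 := by
  have h := (hasDerivAt_xiNum_zero.const_mul 2).div ((hasDerivAt_cos 0).pow 3)
    (by simp)
  have h' : HasDerivAt (fun t => 2 * xiNum t / cos t ^ 3) (2 * (3 - π ^ 2 / 4)) 0 := by
    refine h.congr_deriv ?_
    simp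
  refine h'.congr_of_eventuallyEq ?_
  have hne : ∀ᶠ t in 𝓝 (0 : ℝ), cos t ≠ 0 :=
    continuous_cos.continuousAt.eventually_ne (by simp)
  filter_upwards [hne] with t ht using deriv_xi ht

theorem tendsto_deriv_xi_div_zero :
    Tendsto (fun t => deriv xi t / t) (𝓝[>] 0) (𝓝 (2 * (3 - π ^ 2 / 4))) := by
  have h0 : deriv xi 0 = 0 := by
    rw [deriv_xi (by simp)]
    simp [xiNum]
  have h := hasDerivAt_iff_tendsto_slope.1 hasDerivAt_deriv_xi_zero
  refine (h.mono_left (nhdsWithin_mono _ fun x hx => ne_of_gt hx)).congr fun t => ?_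
  simp [slope_def_field, h0]

/-- The quotient `xiNum / sin`, in expanded form. -/
noncomputable def xiQuot (t : ℝ) : ℝ :=
  cos t ^ 2 + 2 * (t * cos t / sin t) + (t ^ 2 - π ^ 2 / 4)

theorem xiNum_eq_sin_mul_xiQuot {t : ℝ} (hs : sin t ≠ 0) : xiNum t = sin t * xiQuot t := by
  simp only [xiNum, xiQuot]
  field_simp

theorem xiQuot_pi_div_two : xiQuot (π / 2) = 0 := by
  simp [xiQuot]
  ring

theorem hasDerivAt_xiQuot {t : ℝ} (hs : sin t ≠ 0) :
    HasDerivAt xiQuot (2 * cos t ^ 2 * (cos t * sin t - t) / sin t ^ 2) t := by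
  have hsin := hasDerivAt_sin t
  have hcos := hasDerivAt_cos t
  have hid := hasDerivAt_id' t
  have h := ((hcos.pow 2).add (((hid.mul hcos).div hsin hs).const_mul 2)).add
    ((hid.pow 2).sub_const (π ^ 2 / 4))
  refine h.congr_deriv ?_
  simp only [Pi.mul_apply]
  have e := sin_sq_add_cos_sq t
  field_simp
  push_cast
  simp only [pow_one]
  linear_combination (-2 * sin t * cos t) * e

theorem tendsto_deriv_xi_div_pi_div_two :
    Tendsto (fun t => deriv xi t / t) (𝓝[<] (π / 2)) (𝓝 (4 / 3)) := by
  have hpi := pi_pos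
  have hI : ∀ᶠ t in 𝓝[<] (π / 2), t ∈ Ioo 0 (π / 2) :=
    Ioo_mem_nhdsLT (by positivity)
  have hsin : ∀ t ∈ Ioo 0 (π / 2), 0 < sin t := fun t ht =>
    sin_pos_of_pos_of_lt_pi ht.1 (by linarith [ht.2])
  have hcos : ∀ t ∈ Ioo 0 (π / 2), 0 < cos t := fun t ht =>
    cos_pos_of_mem_Ioo ⟨by linarith [ht.1], ht.2⟩
  have hquot : Tendsto (fun t => xiQuot t / cos t ^ 3) (𝓝[<] (π / 2)) (𝓝 (π / 3)) := by
    have hg : ∀ t, HasDerivAt (fun t => cos t ^ 3) (-(3 * cos t ^ 2 * sin t)) t := fun t =>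
      ((hasDerivAt_cos t).pow 3).congr_deriv (by push_cast; ring)
    refine HasDerivAt.lhopital_zero_nhdsLT
      (f' := fun t => 2 * cos t ^ 2 * (cos t * sin t - t) / sin t ^ 2)
      (g' := fun t => -(3 * cos t ^ 2 * sin t)) ?_ ?_ ?_ ?_ ?_ ?_
    · filter_upwards [hI] with t ht using hasDerivAt_xiQuot (hsin t ht).ne'
    · exact Eventually.of_forall hg
    · filter_upwards [hI] with t ht
      have h1 := hsin t ht
      have h2 := hcos t ht
      exact neg_ne_zero.2 (by positivity)
    · have h := (hasDerivAt_xiQuot (t := π / 2) (by simp)).continuousAt.tendsto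
      rw [xiQuot_pi_div_two] at h
      exact h.mono_left nhdsWithin_le_nhds
    · have h := (hg (π / 2)).continuousAt.tendsto
      simp only [cos_pi_div_two, ne_eq, OfNat.ofNat_ne_zero, not_false_eq_true, zero_pow] at h
      exact h.mono_left nhdsWithin_le_nhds
    · have h : ContinuousAt (fun t => 2 * (t - cos t * sin t) / (3 * sin t ^ 3)) (π / 2) :=
        ContinuousAt.div (by fun_prop) (by fun_prop) (by simp)
      have h' := h.tendsto.mono_left (nhdsWithin_le_nhds (s := Iio (π / 2)))
      have hval : 2 * (π / 2 - cos (π / 2) * sin (π / 2)) / (3 * sin (π / 2) ^ 3) = π / 3 := by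
        simp
        ring
      rw [hval] at h'
      refine h'.congr' ?_
      filter_upwards [hI] with t ht
      have h1 := (hsin t ht).ne'
      have h2 := (hcos t ht).ne'
      field_simp
      ring
  have hfac : Tendsto (fun t => 2 * sin t / t) (𝓝[<] (π / 2)) (𝓝 (2 * sin (π / 2) / (π / 2))) :=
    (ContinuousAt.div (f := fun t => 2 * sin t) (g := fun t => t) (by fun_prop) (by fun_prop)
      (by positivity)).tendsto.mono_left nhdsWithin_le_nhds
  have hmul := hfac.mul hquot
  have hval : 2 * sin (π / 2) / (π / 2) * (π / 3) = 4 / 3 := by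
    rw [sin_pi_div_two]
    field_simp
    norm_num
  rw [hval] at hmul
  refine hmul.congr' ?_
  filter_upwards [hI] with t ht
  have h1 := (hsin t ht).ne'
  have h2 := (hcos t ht).ne'
  have h3 := ht.1.ne'
  rw [deriv_xi h2, xiNum_eq_sin_mul_xiQuot h1]
  field_simp

/-- The comparison function whose sign on `(0, π / 2)` is that of `ξ' t / t - k`. -/
noncomputable def xiGap (k t : ℝ) : ℝ :=
  2 * xiQuot t - k * (t * cos t ^ 3 / sin t)

/-- The derivative of `xiGap k` up to the factor `cot ^ 2`. -/
noncomputable def xiGapSlope (k t : ℝ) : ℝ :=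
  (3 * k - 4) * t + (4 - k) * (sin t * cos t) - 2 * k * (t * cos t ^ 2)

theorem hasDerivAt_xiGap (k : ℝ) {t : ℝ} (hs : sin t ≠ 0) :
    HasDerivAt (xiGap k) (xiGapSlope k t * (cos t ^ 2 / sin t ^ 2)) t := by
  have h := ((hasDerivAt_xiQuot hs).const_mul 2).sub
    ((((hasDerivAt_id' t).mul ((hasDerivAt_cos t).pow 3)).div (hasDerivAt_sin t) hs).const_mul k)
  refine h.congr_deriv ?_
  simp only [xiGapSlope, Pi.mul_apply, Pi.pow_apply]
  have e := sin_sq_add_cos_sq t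
  field_simp
  push_cast
  linear_combination (3 * k * t * cos t ^ 2) * e

theorem hasDerivAt_xiGapSlope (k t : ℝ) :
    HasDerivAt (xiGapSlope k) (4 * sin t * (k * (t * cos t) - (2 - k) * sin t)) t := by
  have hsin := hasDerivAt_sin t
  have hcos := hasDerivAt_cos t
  have hid := hasDerivAt_id' t
  have h := ((hid.const_mul (3 * k - 4)).add ((hsin.mul hcos).const_mul (4 - k))).sub
    ((hid.mul (hcos.pow 2)).const_mul (2 * k))
  refine h.congr_deriv ?_
  simp only [Pi.pow_apply]
  push_cast
  simp only [pow_one]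
  linear_combination (4 - 3 * k) * sin_sq_add_cos_sq t

theorem xiGap_pi_div_two (k : ℝ) : xiGap k (π / 2) = 0 := by
  simp [xiGap, xiQuot_pi_div_two]

theorem tendsto_xiGap_zero :
    Tendsto (xiGap (2 * (3 - π ^ 2 / 4))) (𝓝[>] 0) (𝓝 0) := by
  have h1 : Tendsto (fun t => t / sin t) (𝓝[>] 0) (𝓝 1) := by
    have h := hasDerivAt_iff_tendsto_slope.1 (hasDerivAt_sin 0)
    have h' := (h.mono_left (nhdsWithin_mono _ fun x (hx : x ∈ Ioi 0) => ne_of_gt hx)).inv₀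
      (by simp)
    simp only [cos_zero, inv_one] at h'
    exact h'.congr fun t => by simp [slope_def_field]
  have hc : Tendsto cos (𝓝[>] 0) (𝓝 1) := by
    simpa using (continuous_cos.tendsto 0).mono_left nhdsWithin_le_nhds
  have ht : Tendsto (fun t : ℝ => t) (𝓝[>] 0) (𝓝 0) := nhdsWithin_le_nhds
  have h := ((((hc.pow 2).add ((h1.mul hc).const_mul 2)).add
    ((ht.pow 2).sub_const (π ^ 2 / 4))).const_mul 2).sub
    ((h1.mul (hc.pow 3)).const_mul (2 * (3 - π ^ 2 / 4)))
  have hval : 2 * ((1 : ℝ) ^ 2 + 2 * (1 * 1) + (0 ^ 2 - π ^ 2 / 4)) -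
      2 * (3 - π ^ 2 / 4) * (1 * 1 ^ 3) = 0 := by ring
  rw [hval] at h
  refine h.congr fun t => ?_
  simp only [xiGap, xiQuot]
  ring

theorem deriv_xi_div_sub_eq (k : ℝ) {t : ℝ} (ht : t ∈ Ioo 0 (π / 2)) :
    deriv xi t / t - k = xiGap k t * (sin t / (t * cos t ^ 3)) := by
  have h0 := ht.1.ne'
  have h1 : sin t ≠ 0 := (sin_pos_of_pos_of_lt_pi ht.1 (by linarith [ht.2, pi_pos])).ne'
  have h2 : cos t ≠ 0 := (cos_pos_of_mem_Ioo ⟨by linarith [ht.1, pi_pos], ht.2⟩).ne'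
  rw [deriv_xi h2, xiNum_eq_sin_mul_xiQuot h1, xiGap]
  field_simp

theorem sin_pos_of_mem_Ioc {t : ℝ} (ht : t ∈ Ioc 0 (π / 2)) : 0 < sin t :=
  sin_pos_of_pos_of_lt_pi ht.1 (by linarith [ht.2, pi_pos])

theorem xiGap_four_thirds_nonpos {t : ℝ} (ht : t ∈ Ioo 0 (π / 2)) : xiGap (4 / 3) t ≤ 0 := by
  have hmono : MonotoneOn (xiGap (4 / 3)) (Ioc 0 (π / 2)) := by
    refine monotoneOn_of_hasDerivWithinAt_nonneg (convex_Ioc _ _)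
      (f' := fun t => xiGapSlope (4 / 3) t * (cos t ^ 2 / sin t ^ 2)) ?_ ?_ ?_
    · exact fun u hu =>
        (hasDerivAt_xiGap _ (sin_pos_of_mem_Ioc hu).ne').continuousAt.continuousWithinAt
    · exact fun u hu =>
        (hasDerivAt_xiGap _ (sin_pos_of_mem_Ioc (interior_subset hu)).ne').hasDerivWithinAt
    · intro u hu
      rw [interior_Ioc] at hu
      have hc : 0 < cos u := cos_pos_of_mem_Ioo ⟨by linarith [hu.1, pi_pos], hu.2⟩
      have htan := lt_tan hu.1 hu.2
      rw [tan_eq_sin_div_cos, lt_div_iff₀ hc] at htan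
      have hslope : xiGapSlope (4 / 3) u = 8 / 3 * cos u * (sin u - u * cos u) := by
        simp only [xiGapSlope]
        ring
      rw [hslope]
      have := sub_pos.2 htan
      positivity
  have h := hmono ⟨ht.1, ht.2.le⟩ (right_mem_Ioc.2 (by linarith [pi_pos])) ht.2.le
  rwa [xiGap_pi_div_two] at h

/-- For `1 ≤ k`, the function `k t cos t - (2 - k) sin t` is concave on `[0, π / 2]`. -/
theorem concaveOn_mul_cos_sub_sin {k : ℝ} (hk : 1 ≤ k) :
    ConcaveOn ℝ (Icc 0 (π / 2)) fun t => k * (t * cos t) - (2 - k) * sin t := by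
  have h1 : ∀ t, HasDerivAt (fun t => k * (t * cos t) - (2 - k) * sin t)
      ((2 * k - 2) * cos t - k * (t * sin t)) t := fun t =>
    ((((hasDerivAt_id' t).mul (hasDerivAt_cos t)).const_mul k).sub
      ((hasDerivAt_sin t).const_mul (2 - k))).congr_deriv (by ring)
  have h2 : ∀ t, HasDerivAt (fun t => (2 * k - 2) * cos t - k * (t * sin t))
      (-((3 * k - 2) * sin t + k * (t * cos t))) t := fun t =>
    (((hasDerivAt_cos t).const_mul (2 * k - 2)).sub
      (((hasDerivAt_id' t).mul (hasDerivAt_sin t)).const_mul k)).congr_deriv (by ring)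
  refine concaveOn_of_hasDerivWithinAt2_nonpos (convex_Icc _ _)
    (fun t _ => (h1 t).continuousAt.continuousWithinAt)
    (fun t _ => (h1 t).hasDerivWithinAt) (fun t _ => (h2 t).hasDerivWithinAt) ?_
  intro t ht
  rw [interior_Icc] at ht
  have hc : 0 < cos t := cos_pos_of_mem_Ioo ⟨by linarith [ht.1, pi_pos], ht.2⟩
  have hs := sin_pos_of_mem_Ioc ⟨ht.1, ht.2.le⟩
  have ht0 := ht.1
  have hk' : 0 < 3 * k - 2 := by linarith
  have : 0 < k := by linarith
  exact neg_nonpos.2 (by positivity)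

theorem mul_cos_sub_sin_nonneg_of_le {k u t : ℝ} (hk : 1 ≤ k) (hu : 0 ≤ u) (hut : u ≤ t)
    (ht : t ≤ π / 2) (h : 0 ≤ k * (t * cos t) - (2 - k) * sin t) :
    0 ≤ k * (u * cos u) - (2 - k) * sin u := by
  have hmin := (concaveOn_mul_cos_sub_sin hk).ge_on_segment (x := 0) (y := t) (z := u)
    ⟨le_rfl, by linarith⟩ ⟨by linarith, ht⟩
    (by rw [segment_eq_Icc (hu.trans hut)]; exact ⟨hu, hut⟩)
  refine le_trans (le_min ?_ h) hmin
  simp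

theorem xiGapSlope_nonneg {k t : ℝ} (hk : 1 ≤ k) (ht0 : 0 ≤ t) (ht : t ≤ π / 2)
    (h : 0 ≤ k * (t * cos t) - (2 - k) * sin t) : 0 ≤ xiGapSlope k t := by
  have hmono : MonotoneOn (xiGapSlope k) (Icc 0 t) := by
    refine monotoneOn_of_hasDerivWithinAt_nonneg (convex_Icc _ _)
      (fun u _ => (hasDerivAt_xiGapSlope k u).continuousAt.continuousWithinAt)
      (fun u _ => (hasDerivAt_xiGapSlope k u).hasDerivWithinAt) ?_
    intro u hu
    have hu := interior_subset hu
    have h1 := mul_cos_sub_sin_nonneg_of_le hk hu.1 hu.2 ht h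
    have h2 := sin_nonneg_of_nonneg_of_le_pi hu.1 (by linarith [hu.2, pi_pos])
    positivity
  have := hmono (left_mem_Icc.2 ht0) (right_mem_Icc.2 ht0) ht0
  simpa [xiGapSlope] using this

/-- Once nonnegative at `t`, the function `xiGapSlope k` is nonnegative on `[0, t]`. -/
theorem xiGapSlope_nonneg_of_le {k u t : ℝ} (hk : 1 ≤ k) (hu : 0 ≤ u) (hut : u ≤ t)
    (ht : t ≤ π / 2) (h : 0 ≤ xiGapSlope k t) : 0 ≤ xiGapSlope k u := by
  rcases le_or_gt 0 (k * (u * cos u) - (2 - k) * sin u) with hw | hw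
  · exact xiGapSlope_nonneg hk hu (hut.trans ht) hw
  · have hanti : AntitoneOn (xiGapSlope k) (Icc u t) := by
      refine antitoneOn_of_hasDerivWithinAt_nonpos (convex_Icc _ _)
        (fun v _ => (hasDerivAt_xiGapSlope k v).continuousAt.continuousWithinAt)
        (fun v _ => (hasDerivAt_xiGapSlope k v).hasDerivWithinAt) ?_
      intro v hv
      have hv := interior_subset hv
      have h1 : k * (v * cos v) - (2 - k) * sin v < 0 := by
        by_contra! hcon
        exact absurd (mul_cos_sub_sin_nonneg_of_le hk hu hv.1 (hv.2.trans ht) hcon) (not_le.2 hw)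
      have h2 := sin_nonneg_of_nonneg_of_le_pi (hu.trans hv.1) (by linarith [hv.2, pi_pos])
      exact mul_nonpos_of_nonneg_of_nonpos (by positivity) h1.le
    exact h.trans (hanti (left_mem_Icc.2 hut) (right_mem_Icc.2 hut) hut)

theorem xiGap_nonneg {t : ℝ} (ht : t ∈ Ioo 0 (π / 2)) :
    0 ≤ xiGap (2 * (3 - π ^ 2 / 4)) t := by
  have hk : 1 ≤ 2 * (3 - π ^ 2 / 4) := by nlinarith [pi_lt_d2, pi_pos]
  set k := 2 * (3 - π ^ 2 / 4) with hkdef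
  rcases le_or_gt 0 (xiGapSlope k t) with hp | hp
  · have hmono : MonotoneOn (xiGap k) (Ioc 0 t) := by
      have hsin : ∀ u ∈ Ioc 0 t, sin u ≠ 0 := fun u hu =>
        (sin_pos_of_mem_Ioc ⟨hu.1, hu.2.trans ht.2.le⟩).ne'
      refine monotoneOn_of_hasDerivWithinAt_nonneg (convex_Ioc _ _)
        (fun u hu => (hasDerivAt_xiGap k (hsin u hu)).continuousAt.continuousWithinAt)
        (fun u hu => (hasDerivAt_xiGap k (hsin u (interior_subset hu))).hasDerivWithinAt) ?_
      intro u hu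
      have hu := interior_subset hu
      have := xiGapSlope_nonneg_of_le hk hu.1.le hu.2 ht.2.le hp
      positivity
    refine le_of_tendsto tendsto_xiGap_zero ?_
    filter_upwards [Ioo_mem_nhdsGT ht.1] with u hu
    exact hmono ⟨hu.1, hu.2.le⟩ (right_mem_Ioc.2 ht.1) hu.2.le
  · have hanti : AntitoneOn (xiGap k) (Icc t (π / 2)) := by
      have hsin : ∀ u ∈ Icc t (π / 2), sin u ≠ 0 := fun u hu =>
        (sin_pos_of_mem_Ioc ⟨ht.1.trans_le hu.1, hu.2⟩).ne'
      refine antitoneOn_of_hasDerivWithinAt_nonpos (convex_Icc _ _)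
        (fun u hu => (hasDerivAt_xiGap k (hsin u hu)).continuousAt.continuousWithinAt)
        (fun u hu => (hasDerivAt_xiGap k (hsin u (interior_subset hu))).hasDerivWithinAt) ?_
      intro u hu
      have hu := interior_subset hu
      have h1 : xiGapSlope k u < 0 := by
        by_contra! hcon
        exact absurd (xiGapSlope_nonneg_of_le hk ht.1.le hu.1 hu.2 hcon) (not_le.2 hp)
      exact mul_nonpos_of_nonpos_of_nonneg h1.le (by positivity)
    have h := hanti (left_mem_Icc.2 ht.2.le) (right_mem_Icc.2 ht.2.le) ht.2.le
    rwa [xiGap_pi_div_two] at h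

theorem stmt_13 :
    (∀ t ∈ Ioo 0 (π / 2),
        2 * (3 - π ^ 2 / 4) ≤ deriv xi t / t ∧ deriv xi t / t ≤ 4 / 3) ∧
    Filter.Tendsto (fun t => deriv xi t / t) (nhdsWithin 0 (Ioi 0))
      (nhds (2 * (3 - π ^ 2 / 4))) ∧
    deriv (deriv xi) 0 = 2 * (3 - π ^ 2 / 4) ∧
    Filter.Tendsto (fun t => deriv xi t / t) (nhdsWithin (π / 2) (Iio (π / 2)))
      (nhds (4 / 3)) := by
  refine ⟨fun t ht => ?_, tendsto_deriv_xi_div_zero, hasDerivAt_deriv_xi_zero.deriv,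
    tendsto_deriv_xi_div_pi_div_two⟩
  have h0 := ht.1
  have hs := sin_pos_of_mem_Ioc ⟨ht.1, ht.2.le⟩
  have hc : 0 < cos t := cos_pos_of_mem_Ioo ⟨by linarith [ht.1, pi_pos], ht.2⟩
  have hfac : 0 ≤ sin t / (t * cos t ^ 3) := by positivity
  constructor
  · rw [← sub_nonneg, deriv_xi_div_sub_eq _ ht]
    exact mul_nonneg (xiGap_nonneg ht) hfac
  · rw [← sub_nonpos, deriv_xi_div_sub_eq _ ht]
    exact mul_nonpos_of_nonpos_of_nonneg (xiGap_four_thirds_nonpos ht) hfac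
end
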